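/- (Theorem 1, trajectory form) Let G=(N,E) be a finite simple undirected connected graph with n nodes, p edges, and incidence matrix D∈ℝ^{n×p}. For each edge e_k=(i,j)∈E let ϑ_k:ℝ→ℝ be Borel measurable with ϑ_k(0)=0 and α̲_k ≤ ϑ_k(x)/x ≤ ᾱ_k for all x≠0, where 0<α̲_k≤ᾱ_k<∞, and let ν_k≤0, γ_k≤0, β_k∈ℝ be constants. Let y_1,…,y_n and w_1,…,w_p be locally square-integrable functions on [0,∞); set Y=(y_1,…,y_n)ᵀ, W=(w_1,…,w_p)ᵀ, v_k(t)=ϑ_k((DᵀY+W)_k(t)), V=(v_1,…,v_p)ᵀ, and u_i := −(DV)_i. Assume that for every edge e_k=(i,j) and every T≥0, ⟨u_i−u_j, y_i−y_j⟩_T ≥ ν_k(‖u_i‖_T² + ‖u_j‖_T²) + γ_k‖y_i−y_j‖_T² + β_k, and that for every edge e_k=(i,j): (2+r̃_k)/ᾱ_k − (1+α̲_k²)r̄_k/(2α̲_k²) + γ_k/α̲_k² − r_i|ν̃_i| − r_j|ν̃_j| > 0, where ν̃_i = Σ_{e_k∈E_i} ν_k. Then there exist constants ρ>0 and ε≥0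 such that ‖DᵀY‖_T ≤ ρ‖W‖_T + ε for all T≥0. -/

import Mathlib

open Matrix Finset MeasureTheory

/-- The exclusive neighbour set `N_i^j = {l ∈ N_i : l ∉ N_i ∩ N_j, l ≠ j}`. -/
def exclNbr {n : ℕ} (G : SimpleGraph (Fin n)) [DecidableRel G.Adj]
    (i j : Fin n) : Finset (Fin n) :=
  (G.neighborFinset i).filter
    (fun l => l ∉ G.neighborFinset i ∩ G.neighborFinset j ∧ l ≠ j)

lemma dart_sum {n p : ℕ} (G : SimpleGraph (Fin n)) [DecidableRel G.Adj]
    (epos eneg : Fin p → Fin n)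
    (hadj : ∀ k, G.Adj (epos k) (eneg k))
    (hinj : Function.Injective (fun k : Fin p => s(epos k, eneg k)))
    (hsurj : ∀ a b : Fin n, G.Adj a b → ∃ k, s(epos k, eneg k) = s(a, b))
    (H : Fin n → Fin n → ℝ) :
    ∑ a, ∑ b, (if G.Adj a b then H a b else 0)
      = ∑ k, (H (epos k) (eneg k) + H (eneg k) (epos k)) := by
  have key : ∀ a b, (if G.Adj a b then H a b else 0)
      = ∑ k, ((if epos k = a then (if eneg k = b then H a b else 0) else 0)
          + (if eneg k = a then (if epos k = b then H a b else 0) else 0)) := by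
    intro a b
    by_cases hab : G.Adj a b
    · obtain ⟨k0, hk0⟩ := hsurj a b hab
      have hne := hab.ne
      rw [Finset.sum_eq_single k0]
      · rw [Sym2.eq_iff] at hk0
        rcases hk0 with ⟨h1, h2⟩ | ⟨h1, h2⟩
        · simp [h1, h2, hab, hne.symm]
        · simp [h1, h2, hab, hne.symm]
      · intro k _ hk
        have h1 : ¬ (epos k = a ∧ eneg k = b) := by
          rintro ⟨h1, h2⟩
          exact hk (hinj (by simp only [hk0, h1, h2]))
        have h2 : ¬ (eneg k = a ∧ epos k = b) := by
          rintro ⟨h1, h2⟩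
          exact hk (hinj (by simp only [hk0, h1, h2, Sym2.eq_swap]))
        simp only [← ite_and, h1, h2, if_false, add_zero]
      · simp
    · rw [if_neg hab, Finset.sum_eq_zero]
      intro k _
      have h1 : ¬ (epos k = a ∧ eneg k = b) := by
        rintro ⟨h1, h2⟩; exact hab (h1 ▸ h2 ▸ hadj k)
      have h2 : ¬ (eneg k = a ∧ epos k = b) := by
        rintro ⟨h1, h2⟩; exact hab (h1 ▸ h2 ▸ (hadj k).symm)
      simp only [← ite_and, h1, h2, if_false, add_zero]
  simp_rw [key]
  have : ∀ a, ∑ b, ∑ k, ((if epos k = a then (if eneg k = b then H a b else 0) else 0)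
          + (if eneg k = a then (if epos k = b then H a b else 0) else 0))
      = ∑ k, ((if epos k = a then H a (eneg k) else 0)
          + (if eneg k = a then H a (epos k) else 0)) := by
    intro a
    rw [Finset.sum_comm]
    refine Finset.sum_congr rfl fun k _ => ?_
    rw [Finset.sum_add_distrib]
    congr 1
    · split_ifs <;> simp
    · split_ifs <;> simp
  simp_rw [this]
  rw [Finset.sum_comm]
  refine Finset.sum_congr rfl fun k _ => ?_
  rw [Finset.sum_add_distrib]
  simp

/-- antisymmetric extension of an edge function -/
lemma exists_anti {n p : ℕ} (G : SimpleGraph (Fin n)) [DecidableRel G.Adj]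
    (epos eneg : Fin p → Fin n)
    (hadj : ∀ k, G.Adj (epos k) (eneg k))
    (hinj : Function.Injective (fun k : Fin p => s(epos k, eneg k)))
    (v : Fin p → ℝ) :
    ∃ V : Fin n → Fin n → ℝ, (∀ a b, V a b = - V b a) ∧ ∀ k, V (epos k) (eneg k) = v k := by
  refine ⟨fun a b => ∑ k, v k * ((if epos k = a ∧ eneg k = b then 1 else 0)
    - (if epos k = b ∧ eneg k = a then 1 else 0)), ?_, ?_⟩
  · intro a b
    rw [← Finset.sum_neg_distrib]
    exact Finset.sum_congr rfl fun k _ => by ring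
  · intro k
    beta_reduce
    rw [Finset.sum_eq_single k]
    · have := (hadj k).ne
      simp [this, this.symm]
    · intro m _ hm
      have h1 : ¬ (epos m = epos k ∧ eneg m = eneg k) := by
        rintro ⟨h1, h2⟩
        exact hm (hinj (by simp only [h1, h2]))
      have h2 : ¬ (epos m = eneg k ∧ eneg m = epos k) := by
        rintro ⟨h1, h2⟩
        exact hm (hinj (by simp only [h1, h2, Sym2.eq_swap]))
      simp only [h1, h2, if_false]; ring
    · simp

/-- node-based combinatorial inequality -/
lemma node_ineq {n : ℕ} (G : SimpleGraph (Fin n)) [DecidableRel G.Adj]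
    (V : Fin n → Fin n → ℝ) (hV : ∀ a b, V a b = - V b a) (y : Fin n → ℝ) :
    - ∑ a, ∑ b, ∑ l, (if G.Adj a b then (1:ℝ) else 0) * (if G.Adj a l then 1 else 0)
        * (V a l * (y a - y b))
    ≤ ∑ a, ∑ b, (if G.Adj a b then
        (- (V a b * (y a - y b))
          - ((G.neighborFinset a ∩ G.neighborFinset b).card : ℝ) / 2 * (V a b * (y a - y b))
          + ((exclNbr G a b).card : ℝ) / 2 * (V a b ^ 2 + (y a - y b) ^ 2)) else 0) := by
  set A : Fin n → Fin n → ℝ := fun a b => if G.Adj a b then (1:ℝ) else 0 with hA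
  have hAs : ∀ a b, A a b = A b a := fun a b => by simp [hA, G.adj_comm]
  have hA0 : ∀ a b, 0 ≤ A a b := fun a b => by simp only [hA]; split_ifs <;> norm_num
  set δ : Fin n → Fin n → ℝ := fun a b => if a = b then (1:ℝ) else 0 with hδ
  set X : Fin n → Fin n → ℝ := fun l b => 1 - δ l b - A l b with hX
  have hXs : ∀ a b, X a b = X b a := fun a b => by simp [hX, hδ, hAs a b, eq_comm]
  have hX0 : ∀ a b, 0 ≤ X a b := fun a b => by
    simp only [hX, hA, hδ]
    by_cases h : a = b
    · subst h; simp
    · by_cases h2 : G.Adj a b <;> simp [h, h2]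
  have hcap : ∀ a l, ((G.neighborFinset a ∩ G.neighborFinset l).card : ℝ)
      = ∑ b, A a b * A l b := by
    intro a l
    rw [Finset.card_eq_sum_ones, Nat.cast_sum]
    have : G.neighborFinset a ∩ G.neighborFinset l
        = univ.filter (fun b => G.Adj a b ∧ G.Adj l b) := by
      ext b; simp
    rw [this, Finset.sum_filter]
    refine Finset.sum_congr rfl fun b _ => ?_
    simp only [hA]
    by_cases h1 : G.Adj a b <;> by_cases h2 : G.Adj l b <;> simp [h1, h2]
  have hexc : ∀ a l, ((exclNbr G a l).card : ℝ) = ∑ b, A a b * X l b := by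
    intro a l
    rw [Finset.card_eq_sum_ones, Nat.cast_sum]
    have : exclNbr G a l
        = univ.filter (fun b => G.Adj a b ∧ ¬ G.Adj l b ∧ b ≠ l) := by
      ext b; simp [exclNbr]; tauto
    rw [this, Finset.sum_filter]
    refine Finset.sum_congr rfl fun b _ => ?_
    simp only [hA, hX, hδ]
    by_cases h3 : b = l
    · subst h3; simp
    · by_cases h1 : G.Adj a b <;> by_cases h2 : G.Adj l b <;> simp [h1, h2, h3, Ne.symm h3]
  have hR : ∀ a b, (if G.Adj a b then
        (- (V a b * (y a - y b))
          - ((G.neighborFinset a ∩ G.neighborFinset b).card : ℝ) / 2 * (V a b * (y a - y b))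
          + ((exclNbr G a b).card : ℝ) / 2 * (V a b ^ 2 + (y a - y b) ^ 2)) else 0)
      = - (A a b * (V a b * (y a - y b)))
        - (∑ l, A a b * A a l * A b l * (V a b * (y a - y b))) / 2
        + (∑ l, A a b * A a l * X b l * (V a b ^ 2 + (y a - y b) ^ 2)) / 2 := by
    intro a b
    have e1 : ∑ l, A a b * A a l * A b l * (V a b * (y a - y b))
        = A a b * (∑ l, A a l * A b l) * (V a b * (y a - y b)) := by
      rw [Finset.mul_sum, Finset.sum_mul]
      exact Finset.sum_congr rfl fun l _ => by ring
    have e2 : ∑ l, A a b * A a l * X b l * (V a b ^ 2 + (y a - y b) ^ 2)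
        = A a b * (∑ l, A a l * X b l) * (V a b ^ 2 + (y a - y b) ^ 2) := by
      rw [Finset.mul_sum, Finset.sum_mul]
      exact Finset.sum_congr rfl fun l _ => by ring
    rw [e1, e2, hcap, hexc]
    simp only [hA]
    split_ifs <;> ring
  simp_rw [hR]
  have hsplit : ∑ a, ∑ b, ∑ l, A a b * A a l * (V a l * (y a - y b))
      = ∑ a, ∑ b, A a b * (V a b * (y a - y b))
        + ∑ a, ∑ b, ∑ l, A a b * A a l * A l b * (V a l * (y a - y b))
        + ∑ a, ∑ b, ∑ l, A a b * A a l * X l b * (V a l * (y a - y b)) := by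
    rw [← Finset.sum_add_distrib, ← Finset.sum_add_distrib]
    refine Finset.sum_congr rfl fun a _ => ?_
    rw [← Finset.sum_add_distrib, ← Finset.sum_add_distrib]
    refine Finset.sum_congr rfl fun b _ => ?_
    have : A a b * (V a b * (y a - y b))
        = ∑ l, δ l b * (A a b * A a l * (V a l * (y a - y b))) := by
      simp only [hδ, ite_mul, one_mul, zero_mul, Finset.sum_ite_eq', Finset.mem_univ, if_true]
      simp only [hA]; split_ifs <;> simp
    rw [this, ← Finset.sum_add_distrib, ← Finset.sum_add_distrib]
    refine Finset.sum_congr rfl fun l _ => ?_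
    simp only [hX]; ring
  have htri : ∑ a, ∑ b, ∑ l, A a b * A a l * A l b * (V a l * (y a - y b))
      = (∑ a, ∑ b, ∑ l, A a b * A a l * A b l * (V a b * (y a - y b))) / 2 := by
    have t1 : ∑ a, ∑ b, ∑ l, A a b * A a l * A l b * (V a l * (y a - y b))
        = ∑ a, ∑ b, ∑ l, A a b * A a l * A b l * (V a b * (y a - y l)) := by
      refine Finset.sum_congr rfl fun a _ => ?_
      rw [Finset.sum_comm]
      refine Finset.sum_congr rfl fun b _ => Finset.sum_congr rfl fun l _ => ?_
      ring
    have t2 : ∑ a, ∑ b, ∑ l, A a b * A a l * A b l * (V a b * (y a - y l))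
        = ∑ a, ∑ b, ∑ l, A a b * A a l * A b l * (V a b * (y l - y b)) := by
      rw [Finset.sum_comm]
      refine Finset.sum_congr rfl fun a _ => Finset.sum_congr rfl fun b _ =>
        Finset.sum_congr rfl fun l _ => ?_
      rw [hV b a, hAs b a]; ring
    have t3 : ∑ a, ∑ b, ∑ l, A a b * A a l * A b l * (V a b * (y a - y b))
        = ∑ a, ∑ b, ∑ l, A a b * A a l * A b l * (V a b * (y a - y l))
          + ∑ a, ∑ b, ∑ l, A a b * A a l * A b l * (V a b * (y l - y b)) := by
      simp only [← Finset.sum_add_distrib]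
      refine Finset.sum_congr rfl fun a _ => Finset.sum_congr rfl fun b _ =>
        Finset.sum_congr rfl fun l _ => ?_
      ring
    rw [t3, ← t2, t1]; ring
  have hcross : - ∑ a, ∑ b, ∑ l, A a b * A a l * X l b * (V a l * (y a - y b))
      ≤ (∑ a, ∑ b, ∑ l, A a b * A a l * X b l * (V a b ^ 2 + (y a - y b) ^ 2)) / 2 := by
    have c1 : ∑ a, ∑ b, ∑ l, A a b * A a l * X b l * (V a b ^ 2 + (y a - y b) ^ 2)
        = ∑ a, ∑ b, ∑ l, A a b * A a l * X l b * (V a l ^ 2 + (y a - y b) ^ 2) := by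
      have d1 : ∑ a, ∑ b, ∑ l, A a b * A a l * X b l * (V a b ^ 2)
          = ∑ a, ∑ b, ∑ l, A a b * A a l * X l b * (V a l ^ 2) := by
        refine Finset.sum_congr rfl fun a _ => ?_
        rw [Finset.sum_comm]
        refine Finset.sum_congr rfl fun b _ => Finset.sum_congr rfl fun l _ => ?_
        ring
      simp only [mul_add, Finset.sum_add_distrib]
      rw [d1]
      congr 1
      refine Finset.sum_congr rfl fun a _ => Finset.sum_congr rfl fun b _ =>
        Finset.sum_congr rfl fun l _ => ?_
      rw [hXs]
    rw [c1]
    simp only [← Finset.sum_neg_distrib, Finset.sum_div]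
    refine Finset.sum_le_sum fun a _ => Finset.sum_le_sum fun b _ =>
        Finset.sum_le_sum fun l _ => ?_
    have h0 : 0 ≤ A a b * A a l * X l b := mul_nonneg (mul_nonneg (hA0 _ _) (hA0 _ _)) (hX0 _ _)
    nlinarith [mul_nonneg h0 (sq_nonneg (V a l + (y a - y b)))]
  simp only [Finset.sum_add_distrib, Finset.sum_sub_distrib, Finset.sum_neg_distrib,
    ← Finset.sum_div]
  rw [hsplit, htri]
  linarith

/-- pointwise inequality on edges -/
lemma edge_ineq {n p : ℕ} (G : SimpleGraph (Fin n)) [DecidableRel G.Adj]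
    (epos eneg : Fin p → Fin n)
    (hadj : ∀ k, G.Adj (epos k) (eneg k))
    (hinj : Function.Injective (fun k : Fin p => s(epos k, eneg k)))
    (hsurj : ∀ a b : Fin n, G.Adj a b → ∃ k, s(epos k, eneg k) = s(a, b))
    (D : Matrix (Fin n) (Fin p) ℝ)
    (hD : ∀ i k, D i k =
      if i = epos k then 1 else if i = eneg k then -1 else 0)
    (ν : Fin p → ℝ) (hν : ∀ k, ν k ≤ 0)
    (y : Fin n → ℝ) (v : Fin p → ℝ) (u : Fin n → ℝ)
    (hu : ∀ i, u i = -(D *ᵥ v) i) :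
    ∑ k, ((u (epos k) - u (eneg k)) * (y (epos k) - y (eneg k))
        - ν k * (u (epos k) ^ 2 + u (eneg k) ^ 2))
    ≤ ∑ k, (- (2 + ((G.neighborFinset (epos k) ∩ G.neighborFinset (eneg k)).card : ℝ))
          * (v k * (y (epos k) - y (eneg k)))
        + (((exclNbr G (epos k) (eneg k)).card
                  + (exclNbr G (eneg k) (epos k)).card : ℕ) : ℝ) / 2
            * (v k ^ 2 + (y (epos k) - y (eneg k)) ^ 2)
        + ((G.degree (epos k) : ℝ)
              * |∑ m ∈ univ.filter (fun m => epos m = epos k ∨ eneg m = epos k), ν m|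
          + (G.degree (eneg k) : ℝ)
              * |∑ m ∈ univ.filter (fun m => epos m = eneg k ∨ eneg m = eneg k), ν m|)
            * v k ^ 2) := by
  have dart := dart_sum G epos eneg hadj hinj hsurj
  obtain ⟨V, hV, hVk⟩ := exists_anti G epos eneg hadj hinj v
  have hVk' : ∀ k, V (eneg k) (epos k) = - v k := fun k => by rw [hV, hVk]
  have huV : ∀ i, u i = - ∑ b, if G.Adj i b then V i b else 0 := by
    intro i
    rw [hu i]
    congr 1
    have := dart (fun a b => if a = i then V a b else 0)
    have h2 : ∑ a, ∑ b, (if G.Adj a b then (if a = i then V a b else 0) else 0)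
        = ∑ b, if G.Adj i b then V i b else 0 := by
      rw [Finset.sum_eq_single i]
      · simp
      · intro a _ ha; simp [ha]
      · simp
    rw [← h2, this]
    simp only [mulVec, dotProduct]
    refine Finset.sum_congr rfl fun k _ => ?_
    rw [hD, hVk, hVk']
    have hne := (hadj k).ne
    by_cases h1 : i = epos k
    · subst h1; simp [hne.symm]
    · by_cases h2 : i = eneg k
      · subst h2; simp [hne, hne.symm]
      · simp [h1, h2, Ne.symm h1, Ne.symm h2]
  -- supply part
  have hS : ∑ k, (u (epos k) - u (eneg k)) * (y (epos k) - y (eneg k))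
      = - ∑ a, ∑ b, ∑ l, (if G.Adj a b then (1:ℝ) else 0) * (if G.Adj a l then 1 else 0)
        * (V a l * (y a - y b)) := by
    have h1 := dart (fun a b => u a * (y a - y b))
    have h2 : ∑ k, (u (epos k) - u (eneg k)) * (y (epos k) - y (eneg k))
        = ∑ k, (u (epos k) * (y (epos k) - y (eneg k)) + u (eneg k) * (y (eneg k) - y (epos k))) :=
      Finset.sum_congr rfl fun k _ => by ring
    rw [h2, ← h1]
    simp only [← Finset.sum_neg_distrib]
    refine Finset.sum_congr rfl fun a _ => Finset.sum_congr rfl fun b _ => ?_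
    rw [huV a]
    split_ifs with hab
    · rw [← Finset.sum_neg_distrib, Finset.sum_mul]
      refine Finset.sum_congr rfl fun l _ => ?_
      split_ifs <;> ring
    · simp
  have hnode := node_ineq G V hV y
  rw [← hS, dart] at hnode
  -- ν part
  set N : Fin n → ℝ := fun i => ∑ m ∈ univ.filter (fun m => epos m = i ∨ eneg m = i), ν m with hN
  have hN0 : ∀ i, |N i| = - N i := fun i =>
    abs_of_nonpos (Finset.sum_nonpos fun m _ => hν m)
  have hnu : ∑ k, - (ν k * (u (epos k) ^ 2 + u (eneg k) ^ 2)) = ∑ i, |N i| * u i ^ 2 := by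
    have : ∀ i, |N i| * u i ^ 2 = ∑ k, ((if epos k = i then - ν k * u i ^ 2 else 0)
        + (if eneg k = i then - ν k * u i ^ 2 else 0)) := by
      intro i
      rw [hN0]
      simp only [hN]
      rw [Finset.sum_filter, ← Finset.sum_neg_distrib, Finset.sum_mul]
      refine Finset.sum_congr rfl fun k _ => ?_
      have hne := (hadj k).ne
      by_cases h1 : epos k = i
      · have : eneg k ≠ i := fun h => hne (h1.trans h.symm)
        simp [h1, this]
      · by_cases h2 : eneg k = i <;> simp [h1, h2]
    simp_rw [this]
    rw [Finset.sum_comm]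
    refine Finset.sum_congr rfl fun k _ => ?_
    rw [Finset.sum_add_distrib]
    simp; ring
  have hu2 : ∀ i, u i ^ 2 ≤ G.degree i * ∑ b, if G.Adj i b then V i b ^ 2 else 0 := by
    intro i
    rw [huV, neg_sq, ← Finset.sum_filter, ← Finset.sum_filter]
    have := sq_sum_le_card_mul_sum_sq (s := univ.filter (fun b => G.Adj i b)) (f := V i)
    have hc : (univ.filter (fun b => G.Adj i b)).card = G.degree i := by
      rw [← G.card_neighborFinset_eq_degree]; congr 1; ext b; simp
    rwa [hc] at this
  have hnu2 : ∑ i, |N i| * u i ^ 2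
      ≤ ∑ k, (G.degree (epos k) * |N (epos k)| + G.degree (eneg k) * |N (eneg k)|) * v k ^ 2 := by
    have h1 := dart (fun a b => G.degree a * |N a| * V a b ^ 2)
    have h2 : ∑ k, (G.degree (epos k) * |N (epos k)| + G.degree (eneg k) * |N (eneg k)|) * v k ^ 2
        = ∑ k, (G.degree (epos k) * |N (epos k)| * V (epos k) (eneg k) ^ 2
          + G.degree (eneg k) * |N (eneg k)| * V (eneg k) (epos k) ^ 2) :=
      Finset.sum_congr rfl fun k _ => by rw [hVk, hVk']; ring
    rw [h2, ← h1]
    refine Finset.sum_le_sum fun i _ => ?_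
    refine (mul_le_mul_of_nonneg_left (hu2 i) (abs_nonneg _)).trans (le_of_eq ?_)
    rw [Finset.mul_sum, Finset.mul_sum]
    refine Finset.sum_congr rfl fun b _ => ?_
    split_ifs <;> ring
  simp only [sub_eq_add_neg (_ * _) (_ * _), Finset.sum_add_distrib (f := fun k =>
    (u (epos k) - u (eneg k)) * (y (epos k) - y (eneg k)))]
  rw [hnu]
  rw [Finset.sum_add_distrib (g := fun k => (_ + _) * v k ^ 2)]
  refine add_le_add (hnode.trans (le_of_eq ?_)) hnu2
  refine Finset.sum_congr rfl fun k _ => ?_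
  rw [hVk, hVk', Finset.inter_comm (G.neighborFinset (eneg k))]
  push_cast
  ring

lemma sum_ii {p : ℕ} (f : Fin p → ℝ → ℝ) (T : ℝ) (hT : 0 ≤ T)
    (h : ∀ k ∈ (univ : Finset (Fin p)), IntervalIntegrable (f k) volume 0 T) :
    IntervalIntegrable (fun t => ∑ k, f k t) volume 0 T := by
  rw [intervalIntegrable_iff_integrableOn_Ioc_of_le hT]
  exact integrable_finsetSum _ fun k hk =>
    (intervalIntegrable_iff_integrableOn_Ioc_of_le hT).1 (h k hk)

/-- scalar lemma -/
lemma scalar_bound (a b d lo hi : ℝ) (ha : 0 ≤ a) (hb : 0 ≤ b) (hlo : 0 < lo) (hhi : 0 < hi)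
    (hgap : 0 < a / hi - d - b / lo ^ 2) :
    ∃ M : ℝ, 0 < M ∧ ∀ M', M ≤ M' → ∀ v e w : ℝ,
      v ^ 2 ≤ hi * (v * (e + w)) → lo ^ 2 * (e + w) ^ 2 ≤ v ^ 2 →
      - a * (v * e) + d * v ^ 2 + b * e ^ 2 ≤ - (1 / M') * e ^ 2 + M' * w ^ 2 := by
  set κ := a / hi - d - b / lo ^ 2 with hκ
  have hlo2 : 0 < lo ^ 2 := by positivity
  -- η scales z² against v²
  set η := κ * lo ^ 2 / 8 with hη
  have hη0 : 0 < η := by positivity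
  refine ⟨1 / η + (a ^ 2 / κ + b + b ^ 2 / η + 2 * η), by positivity, ?_⟩
  intro M' hM v e w h1 h2
  have hq : 0 ≤ a ^ 2 / κ + b + b ^ 2 / η + 2 * η := by positivity
  have hM1 : 1 / η ≤ M' := by linarith
  have hM0 : 0 < M' := lt_of_lt_of_le (by positivity) hM1
  have hM2 : 1 / M' ≤ η := by
    rw [div_le_iff₀ hM0]; rw [div_le_iff₀ hη0] at hM1; linarith
  have hM3 : a ^ 2 / κ + b + b ^ 2 / η + 2 * η ≤ M' := by
    have : 0 < 1 / η := by positivity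
    linarith
  set z := e + w with hz
  have he : e = z - w := by rw [hz]; ring
  have i1 : a / hi * v ^ 2 ≤ a * (v * z) := by
    have : a / hi * v ^ 2 ≤ a / hi * (hi * (v * z)) :=
      mul_le_mul_of_nonneg_left h1 (by positivity)
    calc _ ≤ _ := this
      _ = _ := by field_simp
  have i2 : b * z ^ 2 ≤ b / lo ^ 2 * v ^ 2 := by
    calc b * z ^ 2 = b / lo ^ 2 * (lo ^ 2 * z ^ 2) := by field_simp
      _ ≤ _ := mul_le_mul_of_nonneg_left h2 (by positivity)
  have i3 : η * z ^ 2 ≤ κ / 8 * v ^ 2 := by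
    have := mul_le_mul_of_nonneg_left h2 (show 0 ≤ κ / 8 by positivity)
    rw [hη]; linarith
  have i4 : a * (v * w) ≤ κ / 4 * v ^ 2 + a ^ 2 / κ * w ^ 2 := by
    have : κ / 4 * v ^ 2 + a ^ 2 / κ * w ^ 2 - a * (v * w) = (κ * v / 2 - a * w) ^ 2 / κ := by
      field_simp; ring
    have h : 0 ≤ (κ * v / 2 - a * w) ^ 2 / κ := by positivity
    linarith
  have i5 : -2 * b * (z * w) ≤ η * z ^ 2 + b ^ 2 / η * w ^ 2 := by
    have : η * z ^ 2 + b ^ 2 / η * w ^ 2 - (-2 * b * (z * w)) = (η * z + b * w) ^ 2 / η := by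
      field_simp; ring
    have h : 0 ≤ (η * z + b * w) ^ 2 / η := by positivity
    linarith
  have i6 : 1 / M' * e ^ 2 ≤ 2 * (η * z ^ 2) + 2 * η * w ^ 2 := by
    have := mul_le_mul_of_nonneg_right hM2 (sq_nonneg e)
    have h2 : e ^ 2 ≤ 2 * z ^ 2 + 2 * w ^ 2 := by rw [he]; nlinarith [sq_nonneg (z + w)]
    have := mul_le_mul_of_nonneg_left h2 hη0.le
    linarith
  have i7 := mul_le_mul_of_nonneg_right hM3 (sq_nonneg w)
  have i8 : b * e ^ 2 = b * z ^ 2 + (-2 * b * (z * w)) + b * w ^ 2 := by rw [he]; ring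
  have i9 : - a * (v * e) = - (a * (v * z)) + a * (v * w) := by rw [he]; ring
  have i10 : (a / hi) * v ^ 2 = κ * v ^ 2 + d * v ^ 2 + b / lo ^ 2 * v ^ 2 := by
    rw [hκ]; ring
  have i11 : 0 ≤ κ * v ^ 2 := by positivity
  rw [i8, i9]
  linarith

/-- Theorem 1, trajectory form: under sector-bounded couplings,
the pairwise edge dissipativity inequalities and the distributed per-edge
conditions, there exist `ρ > 0` and `ε ≥ 0` such that
`‖DᵀY‖_T ≤ ρ‖W‖_T + ε` for all `T ≥ 0`. -/
theorem stmt_13 {n p : ℕ} (G : SimpleGraph (Fin n)) [DecidableRel G.Adj]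
    (hconn : G.Connected)
    (epos eneg : Fin p → Fin n)
    (hadj : ∀ k, G.Adj (epos k) (eneg k))
    (hinj : Function.Injective (fun k : Fin p => s(epos k, eneg k)))
    (hsurj : ∀ a b : Fin n, G.Adj a b → ∃ k, s(epos k, eneg k) = s(a, b))
    (D : Matrix (Fin n) (Fin p) ℝ)
    (hD : ∀ i k, D i k =
      if i = epos k then 1 else if i = eneg k then -1 else 0)
    (ϑ : Fin p → ℝ → ℝ) (αlo αhi : Fin p → ℝ)
    (hαlo : ∀ k, 0 < αlo k) (hαle : ∀ k, αlo k ≤ αhi k)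
    (hϑm : ∀ k, Measurable (ϑ k)) (hϑ0 : ∀ k, ϑ k 0 = 0)
    (hsec : ∀ k, ∀ z : ℝ, z ≠ 0 → αlo k ≤ ϑ k z / z ∧ ϑ k z / z ≤ αhi k)
    (ν γ β : Fin p → ℝ) (hν : ∀ k, ν k ≤ 0) (hγ : ∀ k, γ k ≤ 0)
    (y : Fin n → ℝ → ℝ) (w : Fin p → ℝ → ℝ)
    (hym : ∀ i, Measurable (y i)) (hwm : ∀ k, Measurable (w k))
    (hy2 : ∀ i, ∀ T : ℝ, IntegrableOn (fun t => (y i t) ^ 2) (Set.Ioc 0 T))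
    (hw2 : ∀ k, ∀ T : ℝ, IntegrableOn (fun t => (w k t) ^ 2) (Set.Ioc 0 T))
    (v : Fin p → ℝ → ℝ)
    (hv : ∀ k t, v k t = ϑ k ((Dᵀ *ᵥ (fun i => y i t)) k + w k t))
    (u : Fin n → ℝ → ℝ)
    (hu : ∀ i t, u i t = -(D *ᵥ (fun k => v k t)) i)
    (hedge : ∀ k : Fin p, ∀ T : ℝ, 0 ≤ T →
      (∫ t in (0:ℝ)..T,
          (u (epos k) t - u (eneg k) t) * (y (epos k) t - y (eneg k) t)) ≥
        ν k * ((∫ t in (0:ℝ)..T, (u (epos k) t) ^ 2)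
              + ∫ t in (0:ℝ)..T, (u (eneg k) t) ^ 2)
          + γ k * (∫ t in (0:ℝ)..T, (y (epos k) t - y (eneg k) t) ^ 2)
          + β k)
    (hcond : ∀ k : Fin p,
      0 < (2 + ((G.neighborFinset (epos k) ∩ G.neighborFinset (eneg k)).card : ℝ))
            / αhi k
          - (1 + (αlo k) ^ 2)
              * (((exclNbr G (epos k) (eneg k)).card
                  + (exclNbr G (eneg k) (epos k)).card : ℕ) : ℝ)
              / (2 * (αlo k) ^ 2)
          + γ k / (αlo k) ^ 2
          - (G.degree (epos k) : ℝ)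
              * |∑ m ∈ univ.filter (fun m => epos m = epos k ∨ eneg m = epos k), ν m|
          - (G.degree (eneg k) : ℝ)
              * |∑ m ∈ univ.filter (fun m => epos m = eneg k ∨ eneg m = eneg k), ν m|) :
    ∃ ρ : ℝ, 0 < ρ ∧ ∃ ε : ℝ, 0 ≤ ε ∧ ∀ T : ℝ, 0 ≤ T →
      Real.sqrt (∑ k : Fin p,
          ∫ t in (0:ℝ)..T, ((Dᵀ *ᵥ (fun i => y i t)) k) ^ 2) ≤
        ρ * Real.sqrt (∑ k : Fin p, ∫ t in (0:ℝ)..T, (w k t) ^ 2) + ε := by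
  have he : ∀ k t, (Dᵀ *ᵥ (fun i => y i t)) k = y (epos k) t - y (eneg k) t := by
    intro k t
    have hne := (hadj k).ne
    simp only [mulVec, dotProduct, transpose_apply, hD]
    have : ∀ i, (if i = epos k then (1:ℝ) else if i = eneg k then -1 else 0) * y i t
        = (if i = epos k then y i t else 0) - (if i = eneg k then y i t else 0) := by
      intro i
      by_cases h1 : i = epos k
      · subst h1; simp [hne]
      · by_cases h2 : i = eneg k
        · subst h2; simp [h1]
        · simp [h1, h2]
    simp_rw [this]
    rw [Finset.sum_sub_distrib]
    simp
  have hhi : ∀ k, 0 < αhi k := fun k => (hαlo k).trans_le (hαle k)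
  -- sector facts
  have sec1 : ∀ k z, (ϑ k z) ^ 2 ≤ αhi k * (ϑ k z * z) := by
    intro k z
    by_cases hz : z = 0
    · subst hz; simp [hϑ0]
    · obtain ⟨h1, h2⟩ := hsec k z hz
      obtain ⟨r, hr⟩ : ∃ r, r = ϑ k z / z := ⟨_, rfl⟩
      have hrz : ϑ k z = r * z := by rw [hr]; field_simp
      rw [← hr] at h1 h2
      rw [hrz]
      have hr0 : 0 ≤ r := (hαlo k).le.trans h1
      nlinarith [mul_nonneg (mul_nonneg hr0 (sub_nonneg.2 h2)) (sq_nonneg z)]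
  have sec2 : ∀ k z, (αlo k) ^ 2 * z ^ 2 ≤ (ϑ k z) ^ 2 := by
    intro k z
    by_cases hz : z = 0
    · subst hz; simp [hϑ0]
    · obtain ⟨h1, h2⟩ := hsec k z hz
      obtain ⟨r, hr⟩ : ∃ r, r = ϑ k z / z := ⟨_, rfl⟩
      have hrz : ϑ k z = r * z := by rw [hr]; field_simp
      rw [← hr] at h1 h2
      rw [hrz, mul_pow]
      exact mul_le_mul_of_nonneg_right (pow_le_pow_left₀ (hαlo k).le h1 2) (sq_nonneg z)
  have sec3 : ∀ k z, |ϑ k z| ≤ αhi k * |z| := by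
    intro k z
    by_cases hz : z = 0
    · subst hz; simp [hϑ0]
    · obtain ⟨h1, h2⟩ := hsec k z hz
      have h3 : |ϑ k z / z| ≤ αhi k := by
        rw [abs_of_nonneg ((hαlo k).le.trans h1)]; exact h2
      rwa [abs_div, div_le_iff₀ (abs_pos.2 hz)] at h3
  -- integrability
  have yL : ∀ i T, MemLp (y i) 2 (volume.restrict (Set.Ioc 0 T)) := fun i T =>
    (memLp_two_iff_integrable_sq (hym i).aestronglyMeasurable).2 (hy2 i T)
  have wL : ∀ k T, MemLp (w k) 2 (volume.restrict (Set.Ioc 0 T)) := fun k T =>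
    (memLp_two_iff_integrable_sq (hwm k).aestronglyMeasurable).2 (hw2 k T)
  have eL : ∀ k T, MemLp (fun t => y (epos k) t - y (eneg k) t) 2
      (volume.restrict (Set.Ioc 0 T)) := fun k T => (yL _ T).sub (yL _ T)
  have hv' : ∀ k t, v k t = ϑ k ((y (epos k) t - y (eneg k) t) + w k t) := fun k t => by
    rw [hv, he]
  have vm : ∀ k, Measurable (v k) := by
    intro k
    have : v k = fun t => ϑ k ((y (epos k) t - y (eneg k) t) + w k t) := funext (hv' k)
    rw [this]
    exact (hϑm k).comp (((hym _).sub (hym _)).add (hwm k))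
  have vL : ∀ k T, MemLp (v k) 2 (volume.restrict (Set.Ioc 0 T)) := by
    intro k T
    refine MemLp.of_le_mul (c := αhi k) ((eL k T).add (wL k T)) (vm k).aestronglyMeasurable ?_
    refine Filter.Eventually.of_forall fun t => ?_
    rw [hv']
    exact sec3 k _
  have uL : ∀ i T, MemLp (u i) 2 (volume.restrict (Set.Ioc 0 T)) := by
    intro i T
    have : u i = fun t => ∑ k, (- D i k) * v k t := by
      funext t
      rw [hu]
      simp only [mulVec, dotProduct, ← Finset.sum_neg_distrib, neg_mul]
    rw [this]
    exact memLp_finsetSum _ fun k _ => (vL k T).const_mul _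
  have sqI : ∀ (f : ℝ → ℝ) (T : ℝ), 0 ≤ T → MemLp f 2 (volume.restrict (Set.Ioc 0 T)) →
      IntervalIntegrable (fun t => f t ^ 2) volume 0 T := by
    intro f T hT hf
    rw [intervalIntegrable_iff_integrableOn_Ioc_of_le hT]
    exact hf.integrable_sq
  have mulI : ∀ (f g : ℝ → ℝ) (T : ℝ), 0 ≤ T → MemLp f 2 (volume.restrict (Set.Ioc 0 T)) →
      MemLp g 2 (volume.restrict (Set.Ioc 0 T)) →
      IntervalIntegrable (fun t => f t * g t) volume 0 T := by
    intro f g T hT hf hg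
    rw [intervalIntegrable_iff_integrableOn_Ioc_of_le hT]
    exact hf.integrable_mul hg
  -- scalar bounds
  have hM : ∀ k, ∃ M : ℝ, 0 < M ∧ ∀ M', M ≤ M' → ∀ v e w : ℝ,
      v ^ 2 ≤ αhi k * (v * (e + w)) → (αlo k) ^ 2 * (e + w) ^ 2 ≤ v ^ 2 →
      - (2 + ((G.neighborFinset (epos k) ∩ G.neighborFinset (eneg k)).card : ℝ)) * (v * e)
        + ((((exclNbr G (epos k) (eneg k)).card
                  + (exclNbr G (eneg k) (epos k)).card : ℕ) : ℝ) / 2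
          + ((G.degree (epos k) : ℝ)
              * |∑ m ∈ univ.filter (fun m => epos m = epos k ∨ eneg m = epos k), ν m|
          + (G.degree (eneg k) : ℝ)
              * |∑ m ∈ univ.filter (fun m => epos m = eneg k ∨ eneg m = eneg k), ν m|)) * v ^ 2
        + ((((exclNbr G (epos k) (eneg k)).card
                  + (exclNbr G (eneg k) (epos k)).card : ℕ) : ℝ) / 2 - γ k) * e ^ 2
        ≤ - (1 / M') * e ^ 2 + M' * w ^ 2 := by
    intro k
    refine scalar_bound _ _ _ (αlo k) (αhi k) (by positivity) ?_ (hαlo k) (hhi k) ?_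
    · have := hγ k
      have h0 : (0:ℝ) ≤ (((exclNbr G (epos k) (eneg k)).card
                  + (exclNbr G (eneg k) (epos k)).card : ℕ) : ℝ) / 2 := by positivity
      linarith
    · refine (hcond k).trans_le (le_of_eq ?_)
      have := (hαlo k).ne'
      field_simp
      ring
  choose M hM0 hMk using hM
  obtain ⟨K, hK0, hK⟩ : ∃ K : ℝ, 0 < K ∧ ∀ k, M k ≤ K := by
    refine ⟨1 + ∑ k, M k, ?_, fun k => ?_⟩
    · have := Finset.sum_nonneg fun k (_ : k ∈ univ) => (hM0 k).le
      linarith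
    · have := Finset.single_le_sum (fun k (_ : k ∈ univ) => (hM0 k).le) (Finset.mem_univ k)
      linarith
  -- pointwise inequality
  have hpt : ∀ t, ∑ k, ((u (epos k) t - u (eneg k) t) * (y (epos k) t - y (eneg k) t)
        - ν k * (u (epos k) t ^ 2 + u (eneg k) t ^ 2)
        - γ k * (y (epos k) t - y (eneg k) t) ^ 2)
      ≤ ∑ k, (- (1 / K) * (y (epos k) t - y (eneg k) t) ^ 2 + K * w k t ^ 2) := by
    intro t
    have h1 := edge_ineq G epos eneg hadj hinj hsurj D hD ν hν (fun i => y i t)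
      (fun k => v k t) (fun i => u i t) (fun i => hu i t)
    rw [Finset.sum_sub_distrib]
    refine (sub_le_sub_right h1 _).trans ?_
    rw [← Finset.sum_sub_distrib]
    refine Finset.sum_le_sum fun k _ => ?_
    have h2 := hMk k K (hK k) (v k t) (y (epos k) t - y (eneg k) t) (w k t)
      (by rw [hv']; exact sec1 k _) (by rw [hv']; exact sec2 k _)
    refine le_trans (le_of_eq ?_) h2
    ring
  -- integrated inequality
  have hint : ∀ T, 0 ≤ T → (∑ k, ∫ t in (0:ℝ)..T, (y (epos k) t - y (eneg k) t) ^ 2)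
      ≤ K ^ 2 * (∑ k, ∫ t in (0:ℝ)..T, (w k t) ^ 2) + K * |∑ k, β k| := by
    intro T hT
    have I1 : ∀ k, IntervalIntegrable (fun t =>
        (u (epos k) t - u (eneg k) t) * (y (epos k) t - y (eneg k) t)) volume 0 T := fun k =>
      mulI _ _ T hT ((uL (epos k) T).sub (uL (eneg k) T)) (eL k T)
    have I2 : ∀ i, IntervalIntegrable (fun t => u i t ^ 2) volume 0 T := fun i =>
      sqI _ T hT (uL i T)
    have I3 : ∀ k, IntervalIntegrable (fun t => (y (epos k) t - y (eneg k) t) ^ 2) volume 0 T :=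
      fun k => sqI _ T hT (eL k T)
    have I4 : ∀ k, IntervalIntegrable (fun t => w k t ^ 2) volume 0 T :=
      fun k => sqI _ T hT (wL k T)
    have I5 : ∀ k, IntervalIntegrable (fun t =>
        ν k * (u (epos k) t ^ 2 + u (eneg k) t ^ 2)) volume 0 T := fun k =>
      ((I2 (epos k)).add (I2 (eneg k))).const_mul _
    have IL : ∀ k ∈ (univ : Finset (Fin p)), IntervalIntegrable (fun t =>
        (u (epos k) t - u (eneg k) t) * (y (epos k) t - y (eneg k) t)
        - ν k * (u (epos k) t ^ 2 + u (eneg k) t ^ 2)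
        - γ k * (y (epos k) t - y (eneg k) t) ^ 2) volume 0 T := fun k _ =>
      ((I1 k).sub (I5 k)).sub ((I3 k).const_mul _)
    have IR : ∀ k ∈ (univ : Finset (Fin p)), IntervalIntegrable (fun t =>
        - (1 / K) * (y (epos k) t - y (eneg k) t) ^ 2 + K * w k t ^ 2) volume 0 T := fun k _ =>
      ((I3 k).const_mul _).add ((I4 k).const_mul _)
    have hmono := intervalIntegral.integral_mono (μ := volume) hT
      (sum_ii _ T hT IL)
      (sum_ii _ T hT IR) hpt
    rw [intervalIntegral.integral_finsetSum IL, intervalIntegral.integral_finsetSum IR] at hmono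
    have hl : ∑ k, β k ≤ ∑ k, ∫ t in (0:ℝ)..T,
        ((u (epos k) t - u (eneg k) t) * (y (epos k) t - y (eneg k) t)
        - ν k * (u (epos k) t ^ 2 + u (eneg k) t ^ 2)
        - γ k * (y (epos k) t - y (eneg k) t) ^ 2) := by
      refine Finset.sum_le_sum fun k _ => ?_
      rw [intervalIntegral.integral_sub ((I1 k).sub (I5 k)) ((I3 k).const_mul _),
        intervalIntegral.integral_sub (I1 k) (I5 k), intervalIntegral.integral_const_mul,
        intervalIntegral.integral_const_mul,
        intervalIntegral.integral_add (I2 (epos k)) (I2 (eneg k))]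
      have := hedge k T hT
      linarith
    have hr : ∑ k, ∫ t in (0:ℝ)..T,
        (- (1 / K) * (y (epos k) t - y (eneg k) t) ^ 2 + K * w k t ^ 2)
        = - (1 / K) * (∑ k, ∫ t in (0:ℝ)..T, (y (epos k) t - y (eneg k) t) ^ 2)
          + K * ∑ k, ∫ t in (0:ℝ)..T, (w k t) ^ 2 := by
      rw [Finset.mul_sum, Finset.mul_sum, ← Finset.sum_add_distrib]
      refine Finset.sum_congr rfl fun k _ => ?_
      rw [intervalIntegral.integral_add ((I3 k).const_mul _) ((I4 k).const_mul _),
        intervalIntegral.integral_const_mul, intervalIntegral.integral_const_mul]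
    rw [hr] at hmono
    have h3 := hl.trans hmono
    have h4 := neg_abs_le (∑ k, β k)
    have h5 := mul_le_mul_of_nonneg_left (h4.trans h3) hK0.le
    have h6 : K * (1 / K) = 1 := by field_simp
    have h7 : K * (- (1 / K) * (∑ k, ∫ t in (0:ℝ)..T, (y (epos k) t - y (eneg k) t) ^ 2)
          + K * ∑ k, ∫ t in (0:ℝ)..T, (w k t) ^ 2)
        = - (∑ k, ∫ t in (0:ℝ)..T, (y (epos k) t - y (eneg k) t) ^ 2)
          + K ^ 2 * ∑ k, ∫ t in (0:ℝ)..T, (w k t) ^ 2 := by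
      rw [mul_add, ← mul_assoc, mul_neg, h6]; ring
    rw [h7] at h5
    linarith
  refine ⟨K, hK0, Real.sqrt (K * |∑ k, β k|), Real.sqrt_nonneg _, fun T hT => ?_⟩
  simp_rw [he]
  have hW : 0 ≤ ∑ k, ∫ t in (0:ℝ)..T, (w k t) ^ 2 :=
    Finset.sum_nonneg fun k _ => intervalIntegral.integral_nonneg hT fun t _ => sq_nonneg _
  have hB : 0 ≤ K * |∑ k, β k| := by positivity
  rw [Real.sqrt_le_left (by positivity)]
  refine (hint T hT).trans ?_
  have s1 := Real.sq_sqrt hW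
  have s2 := Real.sq_sqrt hB
  have s3 : 0 ≤ K * Real.sqrt (∑ k, ∫ t in (0:ℝ)..T, (w k t) ^ 2)
      * Real.sqrt (K * |∑ k, β k|) := by positivity
  rw [add_sq, mul_pow, s1, s2]
  linarith
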